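/- Let m ∈ ℕ and let U : ℓ∞^m(ℓ₁^m) → L¹ be a bounded operator whose matrix entries U_{i,j} = U(e_{i,j}), viewed as random variables on [0,1] with Lebesgue measure, form a symmetric sequence: for every choice of signs ε_{i,j} ∈ {±1}, the family (ε_{i,j} U_{i,j}) has the same joint distribution as (U_{i,j}). Then π₂(U) ≤ (∑_{i=1}^m max_{1≤j≤m} ‖U_{i,j}‖_{L²}²)^{1/2}. -/

import Mathlib

open MeasureTheory

noncomputable section

/-- Lebesgue measure on `[0,1]`. -/
abbrev μ01 : Measure ℝ := volume.restrict (Set.Icc 0 1)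

/-- The space `L¹[0,1]`. -/
abbrev L1 : Type := Lp ℝ 1 μ01

/-- `ℓ₁^m`, i.e. `ℝ^m` with the norm `‖a‖₁ = ∑ |aᵢ|`. -/
abbrev ell1 (m : ℕ) : Type := PiLp 1 (fun _ : Fin m => ℝ)

/-- `ℓ∞^m(ℓ₁^m)`: `m × m` matrices with norm `max_i ∑_j |a_{i,j}|`. -/
abbrev Minf (m : ℕ) : Type := PiLp ⊤ (fun _ : Fin m => ell1 m)

/-- The unit vector basis `e_{i,j}` of `ℓ∞^m(ℓ₁^m)`. -/
def eMat (m : ℕ) (i j : Fin m) : Minf m :=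
  (WithLp.equiv ⊤ (Fin m → ell1 m)).symm
    (Pi.single i ((WithLp.equiv 1 (Fin m → ℝ)).symm (Pi.single j 1)))

theorem signs_aux {k m : ℕ} (v : Fin m → Fin k → ℝ) (S : Finset (Fin m)) :
    ∃ ε : Fin m → ℝ, (∀ j, ε j = 1 ∨ ε j = -1) ∧
      ∑ j ∈ S, ∑ s, v j s ^ 2 ≤ ∑ s, (∑ j ∈ S, ε j * v j s) ^ 2 := by
  classical
  induction S using Finset.induction_on with
  | empty => exact ⟨fun _ => 1, fun _ => Or.inl rfl, by simp⟩
  | insert a S ha ih =>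
    obtain ⟨ε, h1, h2⟩ := ih
    have key : ∃ c : ℝ, (c = 1 ∨ c = -1) ∧
        0 ≤ c * ∑ s, (∑ j ∈ S, ε j * v j s) * v a s := by
      by_cases h : 0 ≤ ∑ s, (∑ j ∈ S, ε j * v j s) * v a s
      · exact ⟨1, Or.inl rfl, by linarith⟩
      · exact ⟨-1, Or.inr rfl, by linarith⟩
    obtain ⟨c, hc, hc2⟩ := key
    refine ⟨Function.update ε a c, ?_, ?_⟩
    · intro j
      by_cases hj : j = a
      · subst hj; simpa using hc
      · simpa [Function.update_of_ne hj] using h1 j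
    · have e : ∀ s, ∑ j ∈ insert a S, Function.update ε a c j * v j s
          = c * v a s + ∑ j ∈ S, ε j * v j s := by
        intro s
        rw [Finset.sum_insert ha, Function.update_self]
        congr 1
        refine Finset.sum_congr rfl fun j hj => ?_
        rw [Function.update_of_ne (by rintro rfl; exact ha hj)]
      have hcc : c ^ 2 = 1 := by rcases hc with h | h <;> simp [h]
      have e2 : ∑ s, (c * v a s + ∑ j ∈ S, ε j * v j s) ^ 2
          = ∑ s, v a s ^ 2 + 2 * (c * ∑ s, (∑ j ∈ S, ε j * v j s) * v a s)
            + ∑ s, (∑ j ∈ S, ε j * v j s) ^ 2 := by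
        rw [Finset.mul_sum, Finset.mul_sum, ← Finset.sum_add_distrib, ← Finset.sum_add_distrib]
        refine Finset.sum_congr rfl fun s _ => ?_
        linear_combination (v a s) ^ 2 * hcc
      simp only [e]
      rw [e2, Finset.sum_insert ha]
      linarith

theorem row_bound {k m : ℕ} (z : Fin k → Minf m)
    (hz : ∀ φ : Minf m →L[ℝ] ℝ, ‖φ‖ ≤ 1 → ∑ s, (φ (z s)) ^ 2 ≤ 1) (i : Fin m) :
    ∑ j, ∑ s, (z s i j) ^ 2 ≤ 1 := by
  obtain ⟨ε, h1, h2⟩ := signs_aux (fun j s => z s i j) Finset.univ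
  refine h2.trans ?_
  let L : Minf m →ₗ[ℝ] ℝ :=
    { toFun := fun a => ∑ j, ε j * a i j
      map_add' := by intro a b; simp [mul_add, Finset.sum_add_distrib]
      map_smul' := by
        intro c a
        simp only [PiLp.smul_apply, smul_eq_mul, RingHom.id_apply, Finset.mul_sum]
        exact Finset.sum_congr rfl fun j _ => by ring }
  have hL : ∀ a, ‖L a‖ ≤ 1 * ‖a‖ := by
    intro a
    rw [one_mul]
    refine le_trans ?_ (PiLp.norm_apply_le a i)
    rw [PiLp.norm_eq_of_L1]
    change ‖∑ j, ε j * a i j‖ ≤ _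
    refine (norm_sum_le _ _).trans (Finset.sum_le_sum fun j _ => ?_)
    rw [norm_mul]
    rcases h1 j with h | h <;> simp [h]
  exact hz (L.mkContinuous 1 hL) (L.mkContinuous_norm_le zero_le_one hL)

theorem expand {m : ℕ} (a : Minf m) : a = ∑ p : Fin m × Fin m, a p.1 p.2 • eMat m p.1 p.2 := by
  ext i j
  simp only [WithLp.ofLp_sum, Finset.sum_apply, PiLp.smul_apply, eMat, smul_eq_mul, WithLp.ofLp_smul,
    Pi.smul_apply]
  rw [Fintype.sum_prod_type, Finset.sum_eq_single i, Finset.sum_eq_single j]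
  · simp
  · intro b _ hb; simp [hb.symm]
  · simp
  · intro b _ hb; simp [hb.symm]
  · simp

theorem sq_norm_le (f : L1) (g : ℝ → ℝ) (hg : MemLp g 2 μ01) (h : (f : ℝ → ℝ) =ᵐ[μ01] g) :
    ‖f‖ ^ 2 ≤ ∫ t, g t ^ 2 ∂μ01 := by
  have : IsProbabilityMeasure μ01 := ⟨by simp⟩
  have hgi : Integrable g μ01 := hg.integrable (by norm_num)
  have e : ‖f‖ = ∫ t, |g t| ∂μ01 := by
    rw [L1.norm_eq_integral_norm]
    refine integral_congr_ae ?_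
    filter_upwards [h] with t ht
    rw [ht, Real.norm_eq_abs]
  rw [e]
  set c := ∫ t, |g t| ∂μ01 with hc
  have h0 : 0 ≤ ∫ t, (|g t| - c) ^ 2 ∂μ01 := integral_nonneg fun t => sq_nonneg _
  have e2 : ∫ t, (|g t| - c) ^ 2 ∂μ01 = ∫ t, g t ^ 2 ∂μ01 - 2 * c * c + c ^ 2 := by
    have : ∀ t, (|g t| - c) ^ 2 = g t ^ 2 - 2 * c * |g t| + c ^ 2 := by
      intro t; rw [sub_sq, sq_abs]; ring
    simp only [this]
    rw [integral_add, integral_sub, integral_const_mul]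
    · simp [← hc]
    · exact hg.integrable_sq
    · exact hgi.abs.const_mul _
    · exact hg.integrable_sq.sub (hgi.abs.const_mul _)
    · exact integrable_const _
  nlinarith

theorem eLp_sq (g : ℝ → ℝ) (hg : MemLp g 2 μ01) :
    eLpNorm g 2 μ01 ^ 2 = ENNReal.ofReal (∫ t, g t ^ 2 ∂μ01) := by
  rw [hg.eLpNorm_eq_integral_rpow_norm (by norm_num) (by norm_num),
    ← ENNReal.ofReal_pow (by positivity)]
  congr 1
  have hn : 0 ≤ ∫ t, g t ^ 2 ∂μ01 := integral_nonneg fun t => sq_nonneg _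
  simp only [ENNReal.toReal_ofNat, Real.rpow_two, Real.norm_eq_abs, sq_abs]
  rw [← Real.rpow_natCast, ← Real.rpow_mul hn]
  norm_num

/-- **2-summing norm estimate for symmetric random matrices.** If the matrix entries
`U_{i,j} = U e_{i,j}` of `U : ℓ∞^m(ℓ₁^m) → L¹` form a symmetric sequence of random
variables (every choice of signs leaves the joint distribution unchanged), then
`π₂(U)² ≤ ∑ᵢ max_j ‖U_{i,j}‖_{L²}²`: for every finite family `z⁽¹⁾,…,z⁽ᵏ⁾` with
`∑ₛ |z*(z⁽ˢ⁾)|² ≤ 1` for all norm-one functionals `z*`, one has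
`∑ₛ ‖U z⁽ˢ⁾‖² ≤ ∑ᵢ max_j ‖U_{i,j}‖_{L²}²`. -/
theorem pi2_bound_symmetric_matrix (m : ℕ) (U : Minf m →L[ℝ] L1)
    (hsym : ∀ ε : Fin m → Fin m → ℝ, (∀ i j, ε i j = 1 ∨ ε i j = -1) →
      Measure.map (fun t : ℝ => fun p : Fin m × Fin m =>
          ε p.1 p.2 * (U (eMat m p.1 p.2) : ℝ → ℝ) t) μ01
        = Measure.map (fun t : ℝ => fun p : Fin m × Fin m =>
          (U (eMat m p.1 p.2) : ℝ → ℝ) t) μ01) :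
    ∀ (k : ℕ) (z : Fin k → Minf m),
      (∀ φ : Minf m →L[ℝ] ℝ, ‖φ‖ ≤ 1 → ∑ s, (φ (z s)) ^ 2 ≤ 1) →
      ENNReal.ofReal (∑ s, ‖U (z s)‖ ^ 2)
        ≤ ∑ i : Fin m, ⨆ j : Fin m, (eLpNorm (U (eMat m i j) : ℝ → ℝ) 2 μ01) ^ 2 := by
  classical
  intro k z hz
  by_cases hfin : ∀ p : Fin m × Fin m, MemLp (U (eMat m p.1 p.2) : ℝ → ℝ) 2 μ01
  swap
  · push Not at hfin
    obtain ⟨⟨i, j⟩, hp⟩ := hfin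
    have htop : eLpNorm (U (eMat m i j) : ℝ → ℝ) 2 μ01 = ⊤ := by
      by_contra h
      exact hp ⟨Lp.aestronglyMeasurable _, lt_top_iff_ne_top.2 h⟩
    have h1 : (⊤ : ENNReal) ≤ ⨆ j : Fin m, (eLpNorm (U (eMat m i j) : ℝ → ℝ) 2 μ01) ^ 2 := by
      refine le_trans ?_ (le_iSup _ j)
      rw [htop]; simp
    exact le_top.trans (h1.trans (Finset.single_le_sum
      (f := fun i => ⨆ j : Fin m, (eLpNorm (U (eMat m i j) : ℝ → ℝ) 2 μ01) ^ 2)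
      (fun _ _ => zero_le) (Finset.mem_univ i)))
  set X : Fin m × Fin m → ℝ → ℝ := fun p => (U (eMat m p.1 p.2) : ℝ → ℝ) with hX
  have hmeas : ∀ p, Measurable (X p) := fun p => (Lp.stronglyMeasurable _).measurable
  have horth : ∀ p q, p ≠ q → ∫ t, X p t * X q t ∂μ01 = 0 := by
    intro p q hpq
    let ε : Fin m → Fin m → ℝ := fun i j => if (i, j) = p then -1 else 1
    have h := hsym ε (by intro i j; by_cases h : (i, j) = p <;> simp [ε, h])
    have hF : Measurable (fun x : Fin m × Fin m → ℝ => x p * x q) := by fun_prop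
    have h2 := congrArg (fun ν => ∫ x, x p * x q ∂ν) h
    rw [integral_map, integral_map] at h2
    · have e1 : ε p.1 p.2 = -1 := by simp [ε]
      have e2 : ε q.1 q.2 = 1 := by simp [ε, hpq.symm]
      simp only [e1, e2] at h2
      have h3 : ∫ t, -(X p t * X q t) ∂μ01 = ∫ t, X p t * X q t ∂μ01 := by
        rw [← h2]
        refine integral_congr_ae (Filter.Eventually.of_forall fun t => ?_)
        simp only [hX]; ring
      rw [integral_neg] at h3
      linarith
    · exact (measurable_pi_lambda _ fun p => hmeas p).aemeasurable
    · exact hF.aestronglyMeasurable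
    · exact (measurable_pi_lambda _ fun p => (hmeas p).const_mul _).aemeasurable
    · exact hF.aestronglyMeasurable
  set N : Fin m × Fin m → ℝ := fun p => ∫ t, X p t ^ 2 ∂μ01 with hN
  have hN0 : ∀ p, 0 ≤ N p := fun p => integral_nonneg fun t => sq_nonneg _
  have hone : ∀ a : Minf m, ‖U a‖ ^ 2 ≤ ∑ p : Fin m × Fin m, a p.1 p.2 ^ 2 * N p := by
    intro a
    have hae : (U a : ℝ → ℝ) =ᵐ[μ01] fun t => ∑ p : Fin m × Fin m, a p.1 p.2 * X p t := by
      have e : U a = ∑ p : Fin m × Fin m, a p.1 p.2 • U (eMat m p.1 p.2) := by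
        conv_lhs => rw [expand a]
        simp only [map_sum, map_smul]
      rw [e]
      have h2 : ∀ᵐ t ∂μ01, ∀ p : Fin m × Fin m,
          (a p.1 p.2 • U (eMat m p.1 p.2) : L1) t = a p.1 p.2 * X p t := by
        rw [ae_all_iff]
        intro p
        filter_upwards [Lp.coeFn_smul (a p.1 p.2) (U (eMat m p.1 p.2))] with t ht
        rw [ht]; rfl
      filter_upwards [h2, Lp.coeFn_finsetSum Finset.univ
        (fun p : Fin m × Fin m => a p.1 p.2 • U (eMat m p.1 p.2))] with t h2 h3
      rw [h3]
      simp [h2, Finset.sum_apply]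
    refine (sq_norm_le _ _ ?_ hae).trans (le_of_eq ?_)
    · exact memLp_finsetSum _ fun p _ => (hfin p).const_mul _
    · have hint : ∀ p q, Integrable (fun t => X p t * X q t) μ01 :=
        fun p q => (hfin p).integrable_mul (hfin q)
      have e : ∀ t, (∑ p : Fin m × Fin m, a p.1 p.2 * X p t) ^ 2
          = ∑ p : Fin m × Fin m, ∑ q : Fin m × Fin m,
            (a p.1 p.2 * a q.1 q.2) * (X p t * X q t) := by
        intro t
        rw [sq, Finset.sum_mul_sum]
        exact Finset.sum_congr rfl fun p _ => Finset.sum_congr rfl fun q _ => by ring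
      simp only [e]
      rw [integral_finsetSum _ fun p _ => integrable_finsetSum _ fun q _ =>
        (hint p q).const_mul _]
      refine Finset.sum_congr rfl fun p _ => ?_
      rw [integral_finsetSum _ fun q _ => (hint p q).const_mul _]
      rw [Finset.sum_eq_single p]
      · rw [integral_const_mul, hN]
        simp only [sq]
      · intro q _ hq
        rw [integral_const_mul, horth p q hq.symm, mul_zero]
      · simp
  have htot : ∑ s, ‖U (z s)‖ ^ 2 ≤ ∑ i, ∑ j, (∑ s, (z s i j) ^ 2) * N (i, j) := by
    refine (Finset.sum_le_sum fun s _ => hone (z s)).trans (le_of_eq ?_)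
    rw [Finset.sum_comm, Fintype.sum_prod_type]
    simp only [Finset.sum_mul]
  refine (ENNReal.ofReal_le_ofReal htot).trans ?_
  have hsq : ∀ i j, 0 ≤ ∑ s, (z s i j) ^ 2 := fun i j => Finset.sum_nonneg fun s _ => sq_nonneg _
  rw [ENNReal.ofReal_sum_of_nonneg fun i _ => Finset.sum_nonneg fun j _ =>
    mul_nonneg (hsq i j) (hN0 _)]
  refine Finset.sum_le_sum fun i _ => ?_
  rw [ENNReal.ofReal_sum_of_nonneg fun j _ => mul_nonneg (hsq i j) (hN0 _)]
  calc ∑ j, ENNReal.ofReal ((∑ s, (z s i j) ^ 2) * N (i, j))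
      ≤ ∑ j, ENNReal.ofReal (∑ s, (z s i j) ^ 2) *
          ⨆ j : Fin m, (eLpNorm (U (eMat m i j) : ℝ → ℝ) 2 μ01) ^ 2 := by
        refine Finset.sum_le_sum fun j _ => ?_
        rw [ENNReal.ofReal_mul (hsq i j)]
        refine mul_le_mul_right ?_ _
        rw [hN, ← eLp_sq _ (hfin (i, j))]
        exact le_iSup (fun j : Fin m => (eLpNorm (U (eMat m i j) : ℝ → ℝ) 2 μ01) ^ 2) j
    _ = ENNReal.ofReal (∑ j, ∑ s, (z s i j) ^ 2) *
          ⨆ j : Fin m, (eLpNorm (U (eMat m i j) : ℝ → ℝ) 2 μ01) ^ 2 := by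
        rw [← Finset.sum_mul, ENNReal.ofReal_sum_of_nonneg fun j _ => hsq i j]
    _ ≤ 1 * ⨆ j : Fin m, (eLpNorm (U (eMat m i j) : ℝ → ℝ) 2 μ01) ^ 2 := by
        gcongr
        exact ENNReal.ofReal_le_one.2 (row_bound z hz i)
    _ = _ := one_mul _

end
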